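/- arXiv:1701.02821 — 2 statements merged into one kernel-verified Lean document; each statement's English description precedes it below -/
import Mathlib

section
/- Let B be an N x N real generator matrix (B_{i,j} >= 0 for all i != j, and each row of B sums to zero), let theta > 0 and Delta_t > 0, and set M = I - theta * Delta_t * B. Let Y_0 be a probability vector in R^N, i.e., all entries of Y_0 are nonnegative and sum to 1. Then M^T is invertible, and the unique solution Y of the linear system M^T Y = Y_0 is again a probability vector: all entries of Y are nonnegative and sum to 1. -/
open Matrix Finset

/-- Coordinate form of the linear system. -/
lemma step_apply {N : ℕ} (B : Matrix (Fin N) (Fin N) ℝ) (c : ℝ) (Y : Fin N → ℝ) (j : Fin N) :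
    ((1 - c • B)ᵀ *ᵥ Y) j = Y j - c * ∑ i, Y i * B i j := by
  rw [Matrix.transpose_sub, Matrix.sub_mulVec, Matrix.transpose_one, Matrix.one_mulVec,
    Matrix.transpose_smul, Matrix.smul_mulVec]
  simp only [Pi.sub_apply, Pi.smul_apply, smul_eq_mul, Matrix.mulVec, dotProduct,
    Matrix.transpose_apply]
  simp only [mul_comm]

/-- Inverse positivity. -/
lemma step_nonneg {N : ℕ} (B : Matrix (Fin N) (Fin N) ℝ)
    (hoff : ∀ i j, i ≠ j → 0 ≤ B i j) (hrow : ∀ i, ∑ j, B i j = 0) (c : ℝ) (hc : 0 < c)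
    (Y : Fin N → ℝ) (h : ∀ j, 0 ≤ Y j - c * ∑ i, Y i * B i j) (k : Fin N) : 0 ≤ Y k := by
  by_contra! hk
  set S : Finset (Fin N) := Finset.univ.filter (fun j => Y j < 0) with hS
  have h1 : 0 ≤ ∑ j ∈ S, (Y j - c * ∑ i, Y i * B i j) := Finset.sum_nonneg fun j _ => h j
  rw [Finset.sum_sub_distrib, ← Finset.mul_sum, Finset.sum_comm] at h1
  have h2 : 0 ≤ ∑ i, ∑ j ∈ S, Y i * B i j := by
    refine Finset.sum_nonneg fun i _ => ?_
    rw [← Finset.mul_sum]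
    by_cases hi : Y i < 0
    · have h3 := Finset.sum_add_sum_compl S (fun j => B i j)
      rw [hrow i] at h3
      have h4 : 0 ≤ ∑ j ∈ Sᶜ, B i j := by
        refine Finset.sum_nonneg fun j hj => hoff i j ?_
        rintro rfl
        simp [hS, hi] at hj
        linarith
      exact mul_nonneg_of_nonpos_of_nonpos hi.le (by linarith)
    · refine mul_nonneg (not_lt.mp hi) (Finset.sum_nonneg fun j hj => hoff i j ?_)
      rintro rfl
      simp [hS] at hj
      exact hi hj
  have h5 : ∑ j ∈ S, Y j < 0 :=
    Finset.sum_neg (fun j hj => by simpa [hS] using hj) ⟨k, by simpa [hS] using hk⟩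
  have := mul_nonneg hc.le h2
  linarith


/-- Norm- and positivity-preservation of one implicit splitting step of the forward
Kolmogorov scheme: if `B` is a generator matrix, `θ, Δt > 0`, `M = I - θ Δt B`,
and `Y₀` is a probability vector, then `Mᵀ` is invertible and the unique solution
`Y` of `Mᵀ Y = Y₀` is again a probability vector. -/
theorem forward_step_preserves_probability {N : ℕ} (B : Matrix (Fin N) (Fin N) ℝ)
    (hoff : ∀ i j, i ≠ j → 0 ≤ B i j) (hrow : ∀ i, ∑ j, B i j = 0)
    (θ Δt : ℝ) (hθ : 0 < θ) (hΔt : 0 < Δt)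
    (M : Matrix (Fin N) (Fin N) ℝ) (hM : M = 1 - (θ * Δt) • B)
    (Y₀ : Fin N → ℝ) (hY₀ : ∀ i, 0 ≤ Y₀ i) (hsum : ∑ i, Y₀ i = 1) :
    IsUnit Mᵀ
    ∧ ∀ Y : Fin N → ℝ, Mᵀ *ᵥ Y = Y₀ → (∀ i, 0 ≤ Y i) ∧ ∑ i, Y i = 1 := by
  subst hM
  have hc : 0 < θ * Δt := mul_pos hθ hΔt
  have key := step_nonneg B hoff hrow (θ * Δt) hc
  refine ⟨?_, fun Y hY => ⟨?_, ?_⟩⟩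
  · rw [← Matrix.mulVec_injective_iff_isUnit]
    intro X Z hXZ
    have hj := fun j => congrFun hXZ j
    simp only [step_apply] at hj
    have e : ∀ (U V : Fin N → ℝ) (j : Fin N), ∑ i, (U - V) i * B i j
        = ∑ i, U i * B i j - ∑ i, V i * B i j := fun U V j => by
      simp [sub_mul, Finset.sum_sub_distrib]
    ext k
    have a1 := key (X - Z) (fun j => by
      rw [e, Pi.sub_apply, mul_sub]; linarith [hj j]) k
    have a2 := key (Z - X) (fun j => by
      rw [e, Pi.sub_apply, mul_sub]; linarith [hj j]) k
    simp only [Pi.sub_apply] at a1 a2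
    linarith
  · exact key Y fun j => by
      rw [← step_apply, hY]; exact hY₀ j
  · rw [← hsum, ← hY]
    simp only [step_apply]
    rw [Finset.sum_sub_distrib, ← Finset.mul_sum, Finset.sum_comm]
    simp [← Finset.mul_sum, hrow]
end

section
/- Let F_0, F_1, F_2, F_3 be N x N real matrices, F = F_0 + F_1 + F_2 + F_3, let theta != 0 be real and Delta > 0, and suppose the matrices M_i = I - theta * Delta * F_i, i = 1, 2, 3, are invertible. Given a vector p in R^N, define the forward fractional steps: Y_3 = (M_3^T)^{-1} p; Y_2 = (M_2^T)^{-1} Y_3; Y_1 = (M_1^T)^{-1} Y_2; tilde_Y_0 = p - Delta * theta * (F_1^T Y_1 + F_2^T Y_2 + F_3^T Y_3) + (Delta/2) F^T Y_1; tilde_Y_3 = (M_3^T)^{-1} tilde_Y_0; tilde_Y_2 = (M_2^T)^{-1} tilde_Y_3; tilde_Y_1 = (M_1^T)^{-1} tilde_Y_2; and output p' = (I + (Delta/2) F^T) Y_1 - Delta * theta * sum_{i=1}^{3} F_i^T (tilde_Y_i - Y_i) + (I + Delta * F^T)(tilde_Y_1 - Y_1). Then p' = B^T p, where B is the one-step evolution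 matrix of the backward HV scheme: B = M_3^{-1} ( -Delta * theta * F_3 * R_3 + M_2^{-1} ( -Delta * theta * F_2 * R_3 + M_1^{-1} ( I - Delta * theta * F_1 * R_3 + (Delta/2) (F + F * R_3) ) ) ), with R_3 = M_3^{-1} ( -Delta * theta * F_3 + M_2^{-1} ( -Delta * theta * F_2 + M_1^{-1} ( I + Delta * (F - theta * F_1) ) ) ). In other words, the forward splitting scheme for the Kolmogorov equation is the exact adjoint of the backward HV scheme. -/
open Matrix

/-- The forward splitting scheme for the Kolmogorov equation is the exact adjoint
of the backward Hundsdorfer–Verwer scheme: the output of the forward fractional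
steps on a vector `p` equals `Bᵀ p`, where `B` is the one-step evolution matrix of
the backward HV scheme. -/
theorem forward_scheme_adjoint_of_hv {N : ℕ}
    (F0 F1 F2 F3 F : Matrix (Fin N) (Fin N) ℝ) (hF : F = F0 + F1 + F2 + F3)
    (θ Δ : ℝ) (hθ : θ ≠ 0) (hΔ : 0 < Δ)
    (M1 M2 M3 : Matrix (Fin N) (Fin N) ℝ)
    (hM1 : M1 = 1 - (θ * Δ) • F1) (hM2 : M2 = 1 - (θ * Δ) • F2)
    (hM3 : M3 = 1 - (θ * Δ) • F3)
    (hU1 : IsUnit M1) (hU2 : IsUnit M2) (hU3 : IsUnit M3)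
    (p Y1 Y2 Y3 tY0 tY1 tY2 tY3 p' : Fin N → ℝ)
    (hY3 : Y3 = (M3ᵀ)⁻¹ *ᵥ p)
    (hY2 : Y2 = (M2ᵀ)⁻¹ *ᵥ Y3)
    (hY1 : Y1 = (M1ᵀ)⁻¹ *ᵥ Y2)
    (htY0 : tY0 = p - (Δ * θ) • (F1ᵀ *ᵥ Y1 + F2ᵀ *ᵥ Y2 + F3ᵀ *ᵥ Y3)
      + (Δ / 2) • (Fᵀ *ᵥ Y1))
    (htY3 : tY3 = (M3ᵀ)⁻¹ *ᵥ tY0)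
    (htY2 : tY2 = (M2ᵀ)⁻¹ *ᵥ tY3)
    (htY1 : tY1 = (M1ᵀ)⁻¹ *ᵥ tY2)
    (hp' : p' = (1 + (Δ / 2) • Fᵀ) *ᵥ Y1
      - (Δ * θ) • (F1ᵀ *ᵥ (tY1 - Y1) + F2ᵀ *ᵥ (tY2 - Y2) + F3ᵀ *ᵥ (tY3 - Y3))
      + (1 + Δ • Fᵀ) *ᵥ (tY1 - Y1))
    (R3 B : Matrix (Fin N) (Fin N) ℝ)
    (hR3 : R3 = M3⁻¹ * (-(Δ * θ) • F3
      + M2⁻¹ * (-(Δ * θ) • F2 + M1⁻¹ * (1 + Δ • (F - θ • F1)))))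
    (hB : B = M3⁻¹ * (-(Δ * θ) • (F3 * R3)
      + M2⁻¹ * (-(Δ * θ) • (F2 * R3)
        + M1⁻¹ * (1 - (Δ * θ) • (F1 * R3) + (Δ / 2) • (F + F * R3))))) :
    p' = Bᵀ *ᵥ p := by
  have hRv : ∀ v : Fin N → ℝ, R3ᵀ *ᵥ v =
      -(Δ * θ) • (F3ᵀ *ᵥ ((M3ᵀ)⁻¹ *ᵥ v))
      + -(Δ * θ) • (F2ᵀ *ᵥ ((M2ᵀ)⁻¹ *ᵥ ((M3ᵀ)⁻¹ *ᵥ v)))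
      + (1 + Δ • Fᵀ - (Δ * θ) • F1ᵀ) *ᵥ ((M1ᵀ)⁻¹ *ᵥ ((M2ᵀ)⁻¹ *ᵥ ((M3ᵀ)⁻¹ *ᵥ v))) := by
    intro v
    rw [hR3]
    simp only [transpose_mul, transpose_add, transpose_sub, transpose_smul, transpose_one,
      transpose_nonsing_inv, ← mulVec_mulVec, add_mulVec, sub_mulVec, smul_mulVec, one_mulVec]
    module
  have hBv : Bᵀ *ᵥ p = (1 + (Δ / 2) • Fᵀ) *ᵥ Y1 + R3ᵀ *ᵥ (tY0 - p) := by
    rw [hB, htY0, hY1, hY2, hY3]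
    simp only [transpose_mul, transpose_add, transpose_sub, transpose_smul, transpose_one,
      transpose_nonsing_inv, ← mulVec_mulVec, add_mulVec, sub_mulVec, smul_mulVec, one_mulVec,
      mulVec_add, mulVec_sub, mulVec_smul]
    module
  have h3 : (M3ᵀ)⁻¹ *ᵥ (tY0 - p) = tY3 - Y3 := by rw [mulVec_sub, ← htY3, ← hY3]
  have h2 : (M2ᵀ)⁻¹ *ᵥ (tY3 - Y3) = tY2 - Y2 := by rw [mulVec_sub, ← htY2, ← hY2]
  have h1 : (M1ᵀ)⁻¹ *ᵥ (tY2 - Y2) = tY1 - Y1 := by rw [mulVec_sub, ← htY1, ← hY1]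
  rw [hBv, hRv, h3, h2, h1, hp']
  simp only [add_mulVec, sub_mulVec, smul_mulVec, one_mulVec]
  module
end
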